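/- arXiv:2111.01570 — 3 statements merged into one kernel-verified Lean document; each statement's English description precedes it below -/
import Mathlib

section
/- Let b > 0 and let ν_b be the Laplace distribution with scale b. Then for all g, g' ∈ ℝ and every measurable set O ⊆ ℝ, (ν_b.map (fun z => g + z)) O ≤ ENNReal.ofReal (Real.exp (|g − g'| / b)) * (ν_b.map (fun z => g' + z)) O. -/
open MeasureTheory

/-- The Laplace distribution on `ℝ` with scale `b`. -/
noncomputable def laplace (b : ℝ) : Measure ℝ :=
  volume.withDensity (fun x => ENNReal.ofReal (Real.exp (-|x| / b) / (2 * b)))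

theorem laplace_map_const_add_apply (b g : ℝ) {O : Set ℝ} (hO : MeasurableSet O) :
    (laplace b).map (fun z => g + z) O =
      ∫⁻ x in O, ENNReal.ofReal (Real.exp (-|x - g| / b) / (2 * b)) := by
  have hg : Measurable (fun z : ℝ => g + z) := measurable_const_add g
  rw [Measure.map_apply hg hO, laplace, withDensity_apply _ (hg hO),
    ← (measurePreserving_add_left volume g).setLIntegral_comp_preimage hO (by fun_prop)]
  simp only [add_sub_cancel_left]

theorem laplace_density_le (b : ℝ) (hb : 0 < b) (g g' x : ℝ) :
    Real.exp (-|x - g| / b) / (2 * b) ≤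
      Real.exp (|g - g'| / b) * (Real.exp (-|x - g'| / b) / (2 * b)) := by
  rw [← mul_div_assoc, ← Real.exp_add, ← add_div]
  gcongr
  linarith [abs_sub_le x g g']

theorem laplace_mechanism_likelihood_ratio (b : ℝ) (hb : 0 < b) (g g' : ℝ)
    (O : Set ℝ) (hO : MeasurableSet O) :
    (laplace b).map (fun z => g + z) O ≤
      ENNReal.ofReal (Real.exp (|g - g'| / b)) * (laplace b).map (fun z => g' + z) O := by
  rw [laplace_map_const_add_apply b g hO, laplace_map_const_add_apply b g' hO,
    ← lintegral_const_mul _ (by fun_prop)]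
  refine lintegral_mono fun x => ?_
  rw [← ENNReal.ofReal_mul (Real.exp_nonneg _)]
  exact ENNReal.ofReal_le_ofReal (laplace_density_le b hb g g' x)
end

section
/- Let λ > 0 and n ≥ 1. Let μ := Measure.pi (fun _ : Fin n => ν_λ) be the law of n i.i.d. random variables each distributed as the Laplace distribution with scale λ. Then for every ν ≥ λ·√n and every a with 0 < a < √8·ν²/λ, μ {x | a ≤ ∑ i, x i} ≤ ENNReal.ofReal (Real.exp (−a²/(8·ν²))). -/
open MeasureTheory

lemma integrable_exp_mul_mul_exp_neg_abs_div {b t : ℝ} (hb : 0 < b) (ht : |t| < 1 / b) :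
    Integrable (fun x : ℝ => Real.exp (t * x) * (Real.exp (-|x| / b) / (2 * b))) ∧
      ∫ x : ℝ, Real.exp (t * x) * (Real.exp (-|x| / b) / (2 * b)) =
        1 / (1 - (t * b) ^ 2) := by
  obtain ⟨h₁, h₂⟩ := abs_lt.mp ht
  have hneg : 0 < t + 1 / b := by linarith
  have hpos : t - 1 / b < 0 := by linarith
  have eq_neg : Set.EqOn (fun x : ℝ => Real.exp ((t + 1 / b) * x) / (2 * b))
      (fun x => Real.exp (t * x) * (Real.exp (-|x| / b) / (2 * b))) (Set.Iic 0) := by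
    intro x hx
    simp only
    rw [abs_of_nonpos hx, ← mul_div_assoc, ← Real.exp_add]
    congr 2
    ring
  have eq_pos : Set.EqOn (fun x : ℝ => Real.exp ((t - 1 / b) * x) / (2 * b))
      (fun x => Real.exp (t * x) * (Real.exp (-|x| / b) / (2 * b))) (Set.Ioi 0) := by
    intro x hx
    simp only
    rw [abs_of_pos hx, ← mul_div_assoc, ← Real.exp_add]
    congr 2
    ring
  have int_neg := IntegrableOn.congr_fun ((integrableOn_exp_mul_Iic hneg 0).div_const (2 * b))
    eq_neg measurableSet_Iic
  have int_pos := IntegrableOn.congr_fun ((integrableOn_exp_mul_Ioi hpos 0).div_const (2 * b))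
    eq_pos measurableSet_Ioi
  refine ⟨?_, ?_⟩
  · rw [← integrableOn_univ, ← Set.Iic_union_Ioi (a := (0 : ℝ))]
    exact int_neg.union int_pos
  · rw [← intervalIntegral.integral_Iic_add_Ioi int_neg int_pos,
      ← setIntegral_congr_fun measurableSet_Iic eq_neg,
      ← setIntegral_congr_fun measurableSet_Ioi eq_pos, integral_div, integral_div,
      integral_exp_mul_Iic hneg, integral_exp_mul_Ioi hpos]
    have e₁ : t + 1 / b = (1 + t * b) / b := by field_simp; ring
    have e₂ : t - 1 / b = -((1 - t * b) / b) := by field_simp; ring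
    rw [e₁] at hneg ⊢
    rw [e₂] at hpos ⊢
    have p₁ : 0 < 1 + t * b := (div_pos_iff_of_pos_right hb).mp hneg
    have p₂ : 0 < 1 - t * b := (div_pos_iff_of_pos_right hb).mp (neg_lt_zero.mp hpos)
    have e₃ : 1 - (t * b) ^ 2 = (1 + t * b) * (1 - t * b) := by ring
    rw [e₃]
    simp only [mul_zero, Real.exp_zero]
    field_simp
    ring

lemma integrable_exp_mul_laplace {b t : ℝ} (hb : 0 < b) (ht : |t| < 1 / b) :
    Integrable (fun x : ℝ => Real.exp (t * x)) (laplace b) := by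
  rw [laplace, integrable_withDensity_iff (by fun_prop) (by simp)]
  refine (integrable_exp_mul_mul_exp_neg_abs_div hb ht).1.congr (ae_of_all _ fun x => ?_)
  simp only
  rw [ENNReal.toReal_ofReal (by positivity)]

lemma mgf_id_laplace {b t : ℝ} (hb : 0 < b) (ht : |t| < 1 / b) :
    ProbabilityTheory.mgf id (laplace b) t = 1 / (1 - (t * b) ^ 2) := by
  rw [ProbabilityTheory.mgf, laplace,
    integral_withDensity_eq_integral_toReal_smul (by fun_prop) (by simp),
    ← (integrable_exp_mul_mul_exp_neg_abs_div hb ht).2]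
  congr 1 with x
  rw [ENNReal.toReal_ofReal (by positivity), smul_eq_mul, mul_comm, id]

lemma isProbabilityMeasure_laplace {b : ℝ} (hb : 0 < b) : IsProbabilityMeasure (laplace b) := by
  obtain ⟨hint, hval⟩ := integrable_exp_mul_mul_exp_neg_abs_div (t := 0) hb (by simpa using hb)
  simp only [zero_mul, Real.exp_zero, one_mul] at hint hval
  constructor
  rw [laplace, withDensity_apply _ MeasurableSet.univ, Measure.restrict_univ,
    ← ofReal_integral_eq_lintegral_ofReal hint (ae_of_all _ fun x => by positivity), hval]
  simp

lemma one_div_one_sub_le_exp_two_mul {s : ℝ} (h₀ : 0 ≤ s) (h : s ≤ 1 / 2) :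
    1 / (1 - s) ≤ Real.exp (2 * s) := by
  rw [div_le_iff₀ (by linarith)]
  nlinarith [Real.add_one_le_exp (2 * s)]

lemma mgf_sum_pi_laplace {b t : ℝ} (hb : 0 < b) (ht : |t| < 1 / b) (n : ℕ) :
    ProbabilityTheory.mgf (fun x : Fin n → ℝ => ∑ i, x i)
      (Measure.pi fun _ : Fin n => laplace b) t = (1 / (1 - (t * b) ^ 2)) ^ n := by
  have := isProbabilityMeasure_laplace hb
  simp only [ProbabilityTheory.mgf, Finset.mul_sum, Real.exp_sum]
  rw [integral_fintype_prod_eq_pow (fun y : ℝ => Real.exp (t * y)), Fintype.card_fin,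
    ← mgf_id_laplace hb ht]
  rfl

lemma integrable_exp_mul_sum_pi_laplace {b t : ℝ} (hb : 0 < b) (ht : |t| < 1 / b) (n : ℕ) :
    Integrable (fun x : Fin n → ℝ => Real.exp (t * ∑ i, x i))
      (Measure.pi fun _ : Fin n => laplace b) := by
  have := isProbabilityMeasure_laplace hb
  simp only [Finset.mul_sum, Real.exp_sum]
  exact Integrable.fintype_prod (f := fun _ y => Real.exp (t * y))
    fun _ => integrable_exp_mul_laplace hb ht

theorem laplace_sum_concentration (lam : ℝ) (hlam : 0 < lam) (n : ℕ) (hn : 1 ≤ n)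
    (ν a : ℝ) (hν : lam * Real.sqrt n ≤ ν)
    (ha0 : 0 < a) (ha : a < Real.sqrt 8 * ν ^ 2 / lam) :
    Measure.pi (fun _ : Fin n => laplace lam) {x | a ≤ ∑ i, x i} ≤
      ENNReal.ofReal (Real.exp (-a ^ 2 / (8 * ν ^ 2))) := by
  have := isProbabilityMeasure_laplace hlam
  have hn' : (0 : ℝ) < n := by exact_mod_cast hn
  have hν0 : 0 < ν := lt_of_lt_of_le (by positivity) hν
  have hnν : n * lam ^ 2 ≤ ν ^ 2 := by
    calc n * lam ^ 2 = (lam * Real.sqrt n) ^ 2 := by rw [mul_pow, Real.sq_sqrt hn'.le, mul_comm]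
      _ ≤ ν ^ 2 := by gcongr
  set t := a / (4 * ν ^ 2) with ht_def
  have ht0 : 0 < t := by positivity
  have hat : a = 4 * ν ^ 2 * t := by rw [ht_def]; field_simp
  have hs : (t * lam) ^ 2 ≤ 1 / 2 := by
    have h : t * lam ≤ Real.sqrt 8 / 4 := by
      rw [lt_div_iff₀ hlam] at ha
      rw [ht_def, div_mul_eq_mul_div, div_le_div_iff₀ (by positivity) (by norm_num)]
      linarith
    calc (t * lam) ^ 2 ≤ (Real.sqrt 8 / 4) ^ 2 := by gcongr
      _ = 1 / 2 := by rw [div_pow, Real.sq_sqrt (by norm_num)]; norm_num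
  have ht : |t| < 1 / lam := by
    rw [abs_of_pos ht0, lt_div_iff₀ hlam]
    nlinarith
  rw [← ofReal_measureReal]
  apply ENNReal.ofReal_le_ofReal
  calc _ ≤ Real.exp (-t * a) * (1 / (1 - (t * lam) ^ 2)) ^ n := by
        rw [← mgf_sum_pi_laplace hlam ht n]
        exact ProbabilityTheory.measure_ge_le_exp_mul_mgf a ht0.le
          (integrable_exp_mul_sum_pi_laplace hlam ht n)
    _ ≤ Real.exp (-t * a) * Real.exp (2 * (t * lam) ^ 2) ^ n := by
        have : 0 < 1 - (t * lam) ^ 2 := by linarith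
        gcongr
        exact one_div_one_sub_le_exp_two_mul (sq_nonneg _) hs
    _ ≤ Real.exp (-a ^ 2 / (8 * ν ^ 2)) := by
        rw [← Real.exp_nat_mul, ← Real.exp_add]
        gcongr
        have e : -a ^ 2 / (8 * ν ^ 2) = -(2 * ν ^ 2 * t ^ 2) := by
          rw [hat]; field_simp; ring
        rw [e]
        calc -t * a + n * (2 * (t * lam) ^ 2)
            = -(4 * ν ^ 2 * t ^ 2) + 2 * t ^ 2 * (n * lam ^ 2) := by
              linear_combination -t * hat
          _ ≤ -(4 * ν ^ 2 * t ^ 2) + 2 * t ^ 2 * ν ^ 2 := by gcongr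
          _ = _ := by ring
end

section
/- Let M, n, A, j, T ≥ 1 be natural numbers and ε > 0 a real number, and assume Real.log (8·A·j²·T) < M. Set λ := 1/(M·ε·n) and let μ := Measure.pi (fun _ : Fin M => ν_λ) be the law of M i.i.d. random variables each distributed as the Laplace distribution with scale λ. Then μ {l | Real.sqrt (8·Real.log (8·A·j²·T)) / (Real.sqrt M · ε · n) ≤ |∑ i, l i|} ≤ ENNReal.ofReal (1/(4·A·j²·T)). -/
open MeasureTheory

namespace laplace

/-- Integrability and total mass of the Laplace density tilted by `exp (t * x)`. -/
lemma integrable_and_integral_density_mul_exp {b t : ℝ} (hb : 0 < b) (ht : |b * t| < 1) :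
    Integrable (fun x : ℝ => Real.exp (-|x| / b) / (2 * b) * Real.exp (t * x)) ∧
      ∫ x : ℝ, Real.exp (-|x| / b) / (2 * b) * Real.exp (t * x) = 1 / (1 - (b * t) ^ 2) := by
  obtain ⟨hlo, hhi⟩ := abs_lt.mp ht
  have e1 : t + 1 / b = (1 + b * t) / b := by field_simp; ring
  have e2 : t - 1 / b = -((1 - b * t) / b) := by field_simp; ring
  have hpos : 0 < t + 1 / b := by
    rw [e1]; exact div_pos (by linarith) hb
  have hneg : t - 1 / b < 0 := by
    rw [e2]; exact neg_neg_of_pos (div_pos (by linarith) hb)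
  have eIic : Set.EqOn (fun x : ℝ => Real.exp ((t + 1 / b) * x) / (2 * b))
      (fun x : ℝ => Real.exp (-|x| / b) / (2 * b) * Real.exp (t * x)) (Set.Iic 0) := by
    intro x hx
    simp only
    rw [abs_of_nonpos hx, div_mul_eq_mul_div, ← Real.exp_add]
    congr 2; ring
  have eIoi : Set.EqOn (fun x : ℝ => Real.exp ((t - 1 / b) * x) / (2 * b))
      (fun x : ℝ => Real.exp (-|x| / b) / (2 * b) * Real.exp (t * x)) (Set.Ioi 0) := by
    intro x hx
    simp only
    rw [abs_of_pos hx, div_mul_eq_mul_div, ← Real.exp_add]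
    congr 2; ring
  have iIic := IntegrableOn.congr_fun
    ((integrableOn_exp_mul_Iic hpos 0).div_const (2 * b)) eIic measurableSet_Iic
  have iIoi := IntegrableOn.congr_fun
    ((integrableOn_exp_mul_Ioi hneg 0).div_const (2 * b)) eIoi measurableSet_Ioi
  refine ⟨?_, ?_⟩
  · rw [← integrableOn_univ, ← Set.Iic_union_Ioi (a := (0 : ℝ))]
    exact iIic.union iIoi
  · rw [← intervalIntegral.integral_Iic_add_Ioi iIic iIoi,
      ← setIntegral_congr_fun measurableSet_Iic eIic,
      ← setIntegral_congr_fun measurableSet_Ioi eIoi, integral_div, integral_div,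
      integral_exp_mul_Iic hpos, integral_exp_mul_Ioi hneg]
    have h1 : 1 + b * t ≠ 0 := by linarith
    have h2 : 1 - b * t ≠ 0 := by linarith
    have e3 : 1 - (b * t) ^ 2 = (1 + b * t) * (1 - b * t) := by ring
    rw [e1, e2, e3]
    simp only [mul_zero, Real.exp_zero]
    field_simp
    ring

lemma measurable_density (b : ℝ) :
    Measurable fun x : ℝ => ENNReal.ofReal (Real.exp (-|x| / b) / (2 * b)) := by
  fun_prop

lemma isProbabilityMeasure {b : ℝ} (hb : 0 < b) : IsProbabilityMeasure (laplace b) := by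
  obtain ⟨hi, he⟩ := integrable_and_integral_density_mul_exp (t := 0) hb (by simp)
  simp only [zero_mul, mul_zero, Real.exp_zero, mul_one] at hi he
  refine ⟨?_⟩
  rw [laplace, withDensity_apply _ MeasurableSet.univ, setLIntegral_univ,
    ← ofReal_integral_eq_lintegral_ofReal hi (ae_of_all _ fun x => by positivity), he]
  simp

lemma integrable_exp_mul {b t : ℝ} (hb : 0 < b) (ht : |b * t| < 1) :
    Integrable (fun x => Real.exp (t * x)) (laplace b) := by
  rw [laplace, integrable_withDensity_iff_integrable_smul' (measurable_density b)
    (ae_of_all _ fun x => ENNReal.ofReal_lt_top)]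
  refine (integrable_and_integral_density_mul_exp hb ht).1.congr (ae_of_all _ fun x => ?_)
  simp only [smul_eq_mul]
  rw [ENNReal.toReal_ofReal (by positivity)]

lemma integral_exp_mul {b t : ℝ} (hb : 0 < b) (ht : |b * t| < 1) :
    ∫ x, Real.exp (t * x) ∂(laplace b) = 1 / (1 - (b * t) ^ 2) := by
  rw [laplace, integral_withDensity_eq_integral_toReal_smul (measurable_density b)
    (ae_of_all _ fun x => ENNReal.ofReal_lt_top), ← (integrable_and_integral_density_mul_exp hb ht).2]
  refine integral_congr_ae (ae_of_all _ fun x => ?_)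
  simp only [smul_eq_mul]
  rw [ENNReal.toReal_ofReal (by positivity)]

lemma integrable_exp_mul_sum {ι : Type*} [Fintype ι] {b t : ℝ} (hb : 0 < b)
    (ht : |b * t| < 1) :
    Integrable (fun l : ι → ℝ => Real.exp (t * ∑ i, l i))
      (Measure.pi fun _ : ι => laplace b) := by
  have := isProbabilityMeasure hb
  simp_rw [Finset.mul_sum, Real.exp_sum]
  exact Integrable.fintype_prod fun _ => integrable_exp_mul hb ht

lemma mgf_sum {ι : Type*} [Fintype ι] {b t : ℝ} (hb : 0 < b) (ht : |b * t| < 1) :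
    ProbabilityTheory.mgf (fun l : ι → ℝ => ∑ i, l i) (Measure.pi fun _ : ι => laplace b) t =
      (1 / (1 - (b * t) ^ 2)) ^ Fintype.card ι := by
  have := isProbabilityMeasure hb
  simp_rw [ProbabilityTheory.mgf, Finset.mul_sum, Real.exp_sum]
  rw [integral_fintype_prod_eq_pow (fun x : ℝ => Real.exp (t * x)), integral_exp_mul hb ht]

end laplace

lemma one_div_one_sub_le_exp_two_mul_s4 {u : ℝ} (h0 : 0 ≤ u) (h1 : u ≤ 1 / 2) :
    1 / (1 - u) ≤ Real.exp (2 * u) := by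
  rw [div_le_iff₀ (by linarith)]
  have := mul_le_mul_of_nonneg_right (Real.add_one_le_exp (2 * u)) (by linarith : 0 ≤ 1 - u)
  nlinarith

/-- Sub-exponential concentration for sums of i.i.d. Laplace variables, in the regime where the
deviation parameter `L` is at most the number of summands. -/
lemma laplace.measure_abs_sum_ge_le {ι : Type*} [Fintype ι] [Nonempty ι] {b L : ℝ} (hb : 0 < b)
    (hL : 0 ≤ L) (hLM : L ≤ Fintype.card ι) :
    Measure.pi (fun _ : ι => laplace b)
        {l | b * (Real.sqrt (Fintype.card ι) * Real.sqrt (8 * L)) ≤ |∑ i, l i|} ≤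
      ENNReal.ofReal (2 * Real.exp (-L)) := by
  have := isProbabilityMeasure hb
  set M : ℝ := (Fintype.card ι : ℝ) with hMdef
  have hM : 0 < M := by simp [hMdef, Fintype.card_pos]
  set s := Real.sqrt (L / (2 * M)) with hs
  have hs2 : s ^ 2 = L / (2 * M) := Real.sq_sqrt (by positivity)
  have hs0 : 0 ≤ s := Real.sqrt_nonneg _
  have hshalf : s ^ 2 ≤ 1 / 2 := by
    rw [hs2, div_le_iff₀ (by positivity)]; linarith
  have hs1 : |s| < 1 := by rw [abs_of_nonneg hs0]; nlinarith
  have hbt : b * (s / b) = s := by field_simp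
  have hbt' : b * (-(s / b)) = -s := by field_simp
  set τ := b * (Real.sqrt M * Real.sqrt (8 * L)) with hτ
  have hexp : s / b * τ = 2 * L := by
    have : s / b * τ = Real.sqrt (L / (2 * M)) * (Real.sqrt M * Real.sqrt (8 * L)) := by
      rw [hτ, hs]; field_simp
    rw [this, ← Real.sqrt_mul hM.le, ← Real.sqrt_mul (by positivity),
      show L / (2 * M) * (M * (8 * L)) = (2 * L) ^ 2 by field_simp; ring,
      Real.sqrt_sq (by positivity)]
  have hmgf : (1 / (1 - s ^ 2)) ^ Fintype.card ι ≤ Real.exp L := by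
    calc (1 / (1 - s ^ 2)) ^ Fintype.card ι ≤ Real.exp (2 * s ^ 2) ^ Fintype.card ι :=
          pow_le_pow_left₀ (div_nonneg zero_le_one (by linarith))
            (one_div_one_sub_le_exp_two_mul_s4 (sq_nonneg s) hshalf) _
      _ = Real.exp L := by
          rw [← Real.exp_nat_mul, ← hMdef, hs2]; congr 1; field_simp
  have hbound : Real.exp (-(2 * L)) * (1 / (1 - s ^ 2)) ^ Fintype.card ι ≤ Real.exp (-L) := by
    refine (mul_le_mul_of_nonneg_left hmgf (Real.exp_pos _).le).trans_eq ?_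
    rw [← Real.exp_add]; congr 1; ring
  set P := Measure.pi fun _ : ι => laplace b
  have hup : P.real {l | τ ≤ ∑ i, l i} ≤ Real.exp (-L) := by
    have h := ProbabilityTheory.measure_ge_le_exp_mul_mgf (μ := P)
      (X := fun l : ι → ℝ => ∑ i, l i) τ (t := s / b) (by positivity)
      (integrable_exp_mul_sum hb (by rwa [hbt]))
    rw [mgf_sum hb (by rwa [hbt]), hbt, neg_mul, hexp] at h
    exact h.trans hbound
  have hlow : P.real {l | ∑ i, l i ≤ -τ} ≤ Real.exp (-L) := by
    have h := ProbabilityTheory.measure_le_le_exp_mul_mgf (μ := P)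
      (X := fun l : ι → ℝ => ∑ i, l i) (-τ) (t := -(s / b))
      (neg_nonpos.mpr (by positivity))
      (integrable_exp_mul_sum hb (by rwa [hbt', abs_neg]))
    rw [mgf_sum hb (by rwa [hbt', abs_neg]), hbt', neg_sq, neg_neg, mul_neg, hexp] at h
    exact h.trans hbound
  have hset : {l : ι → ℝ | τ ≤ |∑ i, l i|} = {l | τ ≤ ∑ i, l i} ∪ {l | ∑ i, l i ≤ -τ} := by
    ext l
    simp only [Set.mem_ofPred_eq, Set.mem_union, le_abs]
    exact or_congr_right le_neg
  rw [hset, ← ofReal_measureReal]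
  refine ENNReal.ofReal_le_ofReal ((measureReal_union_le _ _).trans ?_)
  linarith

theorem cdpmab_per_round_noise_bound (M n A j T : ℕ)
    (hM : 1 ≤ M) (hn : 1 ≤ n) (hA : 1 ≤ A) (hj : 1 ≤ j) (hT : 1 ≤ T)
    (ε : ℝ) (hε : 0 < ε) (hlog : Real.log (8 * A * j ^ 2 * T) < M) :
    Measure.pi (fun _ : Fin M => laplace (1 / (M * ε * n)))
        {l | Real.sqrt (8 * Real.log (8 * A * j ^ 2 * T)) / (Real.sqrt M * ε * n) ≤
              |∑ i, l i|} ≤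
      ENNReal.ofReal (1 / (4 * A * j ^ 2 * T)) := by
  have hM0 : (0 : ℝ) < M := by exact_mod_cast hM
  have hn0 : (0 : ℝ) < n := by exact_mod_cast hn
  have hN : 1 ≤ 8 * A * j ^ 2 * T := by
    have : 0 < 8 * A * j ^ 2 * T := by positivity
    omega
  have hN1 : (1 : ℝ) ≤ 8 * A * j ^ 2 * T := by exact_mod_cast hN
  have : Nonempty (Fin M) := ⟨⟨0, hM⟩⟩
  have h := laplace.measure_abs_sum_ge_le (ι := Fin M) (b := 1 / (M * ε * n)) (by positivity)
    (Real.log_nonneg hN1) (by simpa using hlog.le)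
  rw [Fintype.card_fin, Real.exp_neg, Real.exp_log (by linarith)] at h
  have hthr (x : ℝ) : 1 / (M * ε * n) * (Real.sqrt M * x) = x / (Real.sqrt M * ε * n) := by
    have hsq : Real.sqrt M * Real.sqrt M = M := Real.mul_self_sqrt hM0.le
    have hs0 : 0 < Real.sqrt M := Real.sqrt_pos.mpr hM0
    nth_rewrite 1 [← hsq]
    field_simp
  rw [hthr] at h
  convert h using 2
  field_simp
  norm_num
end
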